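/- Let m ≥ 5 be odd, let u be a positive integer with gcd(u, m) = 1, and suppose either (m² − 1)/8 is even and ρ = 1, or (m² − 1)/8 is odd and ρ = 0. Set n = 2^{m−2} + 2^{(m−3)/2} and d = 2^{m−3}. Then for every integer r with 2 ≤ r and 2r ≤ n − 2 such that A_{2r}(C_{D_ρ}^⊥) > 0, the codewords of weight 2r in the dual code C_{D_ρ}^⊥ hold a 2-(n, 2r, λ_r^⊥) design, where λ_r^⊥·n·(n − 1) = 2r·(2r − 1)·A_{2r}(C_{D_ρ}^⊥) and 2^{m−1}·A_{2r}(C_{D_ρ}^⊥) = binom(n, 2r) + (2^{m−1} − 1)·Σ_{(i,j): 0 ≤ i ≤ d, 0 ≤ j ≤ 2^{(m−5)/2}, i + j = r} (−1)^i·binom(d, i)·binom(n − 2d, 2j). -/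

import Mathlib

/-- Hamming weight of a binary vector: the number of nonzero coordinates. -/
noncomputable def wt {ι : Type*} (c : ι → ZMod 2) : ℕ := Nat.card {i : ι // c i ≠ 0}

/-- Number of codewords of Hamming weight `w` in a set of binary vectors. -/
noncomputable def weightCount {ι : Type*} (C : Set (ι → ZMod 2)) (w : ℕ) : ℕ :=
  Nat.card {c : ι → ZMod 2 // c ∈ C ∧ wt c = w}

/-- The dual code: all vectors orthogonal (standard inner product) to every codeword. -/
def dualCode {ι : Type*} (C : Set (ι → ZMod 2)) : Set (ι → ZMod 2) :=
  {x | ∀ c ∈ C, ∑ᶠ i, x i * c i = 0}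

/-- A code is projective if the minimum distance of its dual is at least 3. -/
def IsProjective {ι : Type*} (C : Set (ι → ZMod 2)) : Prop :=
  ∀ x ∈ dualCode C, x ≠ 0 → 3 ≤ wt x

/-- `d` is the minimum distance of `C`: the least Hamming weight of a nonzero codeword. -/
def IsMinDist {ι : Type*} (C : Set (ι → ZMod 2)) (d : ℕ) : Prop :=
  (∃ c ∈ C, c ≠ 0 ∧ wt c = d) ∧ ∀ c ∈ C, c ≠ 0 → d ≤ wt c

/-- The number of nonzero Hamming weights occurring among codewords of `C`. -/
noncomputable def numNonzeroWeights {ι : Type*} (C : Set (ι → ZMod 2)) : ℕ :=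
  Nat.card {i : ℕ | 1 ≤ i ∧ weightCount C i ≠ 0}

/-- The codewords of weight `w` in `C` hold a 2-design with index `lam`: every pair of
distinct coordinate positions lies in the support of exactly `lam` codewords of weight `w`. -/
def HoldsTwoDesign {ι : Type*} (C : Set (ι → ZMod 2)) (w lam : ℕ) : Prop :=
  ∀ p q : ι, p ≠ q →
    Nat.card {c : ι → ZMod 2 // c ∈ C ∧ wt c = w ∧ c p ≠ 0 ∧ c q ≠ 0} = lam

/-- The defining set `D_ρ = {x ∈ F_{2^m} : Tr(x) = 1, Tr(x^{2^u+1}) = ρ}`. -/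
def Dset (m u : ℕ) (ρ : ZMod 2) : Set (GaloisField 2 m) :=
  {x | Algebra.trace (ZMod 2) (GaloisField 2 m) x = 1 ∧
       Algebra.trace (ZMod 2) (GaloisField 2 m) (x ^ (2 ^ u + 1)) = ρ}

/-- The linear map `b ↦ (Tr(b·d))_{d ∈ D_ρ}`. -/
noncomputable def codeMap (m u : ℕ) (ρ : ZMod 2) :
    GaloisField 2 m →ₗ[ZMod 2] (↥(Dset m u ρ) → ZMod 2) :=
  LinearMap.pi fun d =>
    (Algebra.trace (ZMod 2) (GaloisField 2 m)).comp
      (LinearMap.mulRight (ZMod 2) (d : GaloisField 2 m))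

/-- The code `C_{D_ρ} = {(Tr(b·d))_{d ∈ D_ρ} : b ∈ F_{2^m}}`. -/
noncomputable def codeD (m u : ℕ) (ρ : ZMod 2) :
    Submodule (ZMod 2) (↥(Dset m u ρ) → ZMod 2) :=
  LinearMap.range (codeMap m u ρ)

set_option linter.style.haveILetI false
set_option linter.unusedSectionVars false

/-- The sign character of `ZMod 2`. -/
def sg (a : ZMod 2) : ℤ := if a = 0 then 1 else -1

lemma sg_add (a b : ZMod 2) : sg (a + b) = sg a * sg b := by
  revert a b; decide

lemma sg_zero : sg 0 = 1 := by decide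
lemma sg_one : sg 1 = -1 := by decide
lemma sg_sq (a : ZMod 2) : sg a * sg a = 1 := by revert a; decide
lemma sg_cases (a : ZMod 2) : sg a = 1 ∨ sg a = -1 := by revert a; decide
lemma z2_cases (a : ZMod 2) : a = 0 ∨ a = 1 := by revert a; decide
lemma sg_sum {ι : Type*} (s : Finset ι) (f : ι → ZMod 2) :
    sg (∑ i ∈ s, f i) = ∏ i ∈ s, sg (f i) := by
  classical
  induction s using Finset.induction_on with
  | empty => simp [sg_zero]
  | insert a s ha ih => rw [Finset.sum_insert ha, Finset.prod_insert ha, sg_add, ih]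

lemma sum_sg_zero {G : Type*} [AddCommGroup G] [Fintype G] (f : G →+ ZMod 2)
    (hf : ∃ x, f x ≠ 0) : ∑ x, sg (f x) = 0 := by
  obtain ⟨y, hy⟩ := hf
  have hy1 : f y = 1 := (z2_cases _).resolve_left hy
  have h := Equiv.sum_comp (Equiv.addRight y) (fun x => sg (f x))
  simp only [Equiv.coe_addRight, map_add, sg_add, hy1, sg_one] at h
  rw [← Finset.sum_mul] at h
  linarith

section field
variable {F : Type*} [Field F] [Fintype F] [Algebra (ZMod 2) F]

lemma exists_trace_ne (a : F) (ha : a ≠ 0) : ∃ x : F, Algebra.trace (ZMod 2) F (x * a) ≠ 0 := by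
  have := (traceForm_nondegenerate (ZMod 2) F).1 a
  by_contra! h
  apply ha
  apply this
  intro y
  rw [Algebra.traceForm_apply, mul_comm]
  exact h y

lemma sum_sg_trace (a : F) (ha : a ≠ 0) : ∑ x : F, sg (Algebra.trace (ZMod 2) F (x * a)) = 0 :=
  sum_sg_zero ((Algebra.trace (ZMod 2) F).toAddMonoidHom.comp (AddMonoidHom.mulRight a))
    (exists_trace_ne a ha)

lemma charP_two : CharP F 2 := charP_of_injective_algebraMap (algebraMap (ZMod 2) F).injective 2

lemma trace_frob (u : ℕ) (x : F) :
    Algebra.trace (ZMod 2) F (x ^ 2 ^ u) = Algebra.trace (ZMod 2) F x := by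
  induction u with
  | zero => simp
  | succ k ih =>
    haveI : CharP F 2 := charP_two
    rw [← ih, pow_succ, pow_mul]
    have h := Algebra.trace_eq_of_algEquiv (FiniteField.frobeniusAlgEquiv (ZMod 2) F 2) (x ^ 2 ^ k)
    simpa using h

lemma frob_surj (u : ℕ) (z : F) : ∃ w : F, w ^ 2 ^ u = z := by
  haveI : CharP F 2 := charP_two
  have : Function.Injective (iterateFrobenius F 2 u) := RingHom.injective _
  obtain ⟨w, hw⟩ := (Finite.injective_iff_surjective.mp this) z
  exact ⟨w, by rw [← hw, iterateFrobenius_def]⟩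

lemma fixed_two (k m : ℕ) (hm : Fintype.card F = 2 ^ m) (hk : Nat.gcd k m = 1) (z : F)
    (hz : z ^ 2 ^ k = z) : z = 0 ∨ z = 1 := by
  have key : ∀ j, (fun x : F => x ^ 2)^[j] z = z ^ 2 ^ j := by
    intro j
    induction j with
    | zero => simp
    | succ j ih => rw [Function.iterate_succ_apply', ih, pow_succ 2 j, pow_mul]
  have h1 : Function.IsPeriodicPt (fun x : F => x ^ 2) k z := by
    rw [Function.IsPeriodicPt, Function.IsFixedPt, key, hz]
  have h2 : Function.IsPeriodicPt (fun x : F => x ^ 2) m z := by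
    rw [Function.IsPeriodicPt, Function.IsFixedPt, key, ← hm, FiniteField.pow_card]
  have h3 := h1.gcd h2
  rw [hk, Function.IsPeriodicPt, Function.IsFixedPt, key] at h3
  have h4 : z * (z - 1) = 0 := by linear_combination h3
  rcases mul_eq_zero.mp h4 with h | h
  · exact Or.inl h
  · exact Or.inr (sub_eq_zero.mp h)

/-- The Weil sum of `x ^ (2 ^ u + 1) + b x`. -/
noncomputable def gsum (F : Type*) [Field F] [Fintype F] [Algebra (ZMod 2) F] (u : ℕ) (b : F) : ℤ :=
  ∑ x : F, sg (Algebra.trace (ZMod 2) F (x ^ (2 ^ u + 1)) + Algebra.trace (ZMod 2) F (b * x))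

lemma trace_one_eq (m : ℕ) (hm : Fintype.card F = 2 ^ m) (hodd : Odd m) :
    Algebra.trace (ZMod 2) F 1 = 1 := by
  have hf : Module.finrank (ZMod 2) F = m := by
    have := Module.card_eq_pow_finrank (K := ZMod 2) (V := F)
    rw [hm, ZMod.card] at this
    exact (Nat.pow_right_injective le_rfl this).symm
  have h := Algebra.trace_algebraMap (R := ZMod 2) (S := F) 1
  rw [map_one, hf] at h
  rw [h, nsmul_eq_mul, mul_one]
  exact (ZMod.natCast_eq_one_iff_odd).mpr hodd

lemma gold_inner_sum [DecidableEq F] (u m : ℕ) (hm : Fintype.card F = 2 ^ m) (hodd : Odd m) (hu : Nat.gcd u m = 1)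
    (z : F) : ∑ x : F, sg (Algebra.trace (ZMod 2) F (x ^ 2 ^ u * z + x * z ^ 2 ^ u)) =
      if z = 0 ∨ z = 1 then (2 : ℤ) ^ m else 0 := by
  haveI : CharP F 2 := charP_two
  have hcard : ((Finset.univ : Finset F).card : ℤ) = 2 ^ m := by
    rw [Finset.card_univ, hm]; push_cast; rfl
  split_ifs with h
  · have : ∀ x : F, Algebra.trace (ZMod 2) F (x ^ 2 ^ u * z + x * z ^ 2 ^ u) = 0 := by
      intro x
      rcases h with h | h
      · simp [h]
      · rw [h, one_pow, mul_one, mul_one, map_add, trace_frob, CharTwo.add_self_eq_zero]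
    simp only [this, sg_zero, Finset.sum_const, nsmul_eq_mul, mul_one]
    exact hcard
  · obtain ⟨w, hw⟩ := frob_surj u z
    have : ∀ x : F, Algebra.trace (ZMod 2) F (x ^ 2 ^ u * z + x * z ^ 2 ^ u) =
        Algebra.trace (ZMod 2) F (x * (w + z ^ 2 ^ u)) := by
      intro x
      rw [mul_add, map_add, map_add, ← trace_frob u (x * w), mul_pow, hw]
    simp only [this]
    apply sum_sg_trace
    intro h0
    apply h
    have h1 : w = z ^ 2 ^ u := CharTwo.add_eq_zero.mp h0
    apply fixed_two (2 * u) m hm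
    · exact Nat.Coprime.mul_left (Nat.coprime_two_left.mpr hodd) hu
    · rw [two_mul, pow_add, pow_mul, ← h1, hw]

lemma gsum_sq (u m : ℕ) (hm : Fintype.card F = 2 ^ m) (hodd : Odd m) (hu : Nat.gcd u m = 1)
    (b : F) : gsum F u b ^ 2 = 2 ^ m * (1 - sg (Algebra.trace (ZMod 2) F b)) := by
  classical
  haveI : CharP F 2 := charP_two
  have step : gsum F u b ^ 2 = ∑ z : F, sg (Algebra.trace (ZMod 2) F (z ^ (2 ^ u + 1)) +
      Algebra.trace (ZMod 2) F (b * z)) *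
      ∑ x : F, sg (Algebra.trace (ZMod 2) F (x ^ 2 ^ u * z + x * z ^ 2 ^ u)) := by
    rw [sq]
    conv_lhs => arg 1; rw [gsum]
    rw [Finset.sum_mul]
    simp_rw [Finset.mul_sum]
    conv_rhs => rw [Finset.sum_comm]
    apply Finset.sum_congr rfl
    intro x _
    rw [gsum, Finset.mul_sum, ← Equiv.sum_comp (Equiv.addLeft x)]
    apply Finset.sum_congr rfl
    intro z _
    rw [← sg_add, ← sg_add, Equiv.coe_addLeft]
    congr 1
    have e1 : (x + z) ^ (2 ^ u + 1) = x ^ (2 ^ u + 1) + z ^ (2 ^ u + 1)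
        + (x ^ 2 ^ u * z + x * z ^ 2 ^ u) := by
      rw [pow_succ, add_pow_char_pow]; ring
    rw [e1, mul_add, map_add, map_add, map_add, map_add]
    have e2 : ∀ a : ZMod 2, a + a = 0 := by decide
    linear_combination e2 (Algebra.trace (ZMod 2) F (x ^ (2 ^ u + 1))) +
      e2 (Algebra.trace (ZMod 2) F (b * x))
  rw [step]
  simp_rw [gold_inner_sum u m hm hodd hu]
  have h01 : (0 : F) ≠ 1 := zero_ne_one
  rw [← Finset.sum_subset (Finset.subset_univ ({0, 1} : Finset F))]
  · rw [Finset.sum_pair h01]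
    simp [sg_zero, sg_add, trace_one_eq m hm hodd, sg_one]
    ring
  · intro z _ hz
    simp at hz
    simp [hz]

lemma card_eq_two_pow_finrank : Fintype.card F = 2 ^ Module.finrank (ZMod 2) F := by
  have := Module.card_eq_pow_finrank (K := ZMod 2) (V := F)
  rwa [ZMod.card] at this

end field

lemma sum_sg_eq_card {X : Type*} [Fintype X] (f : X → ZMod 2) :
    ∑ x, sg (f x) = (Nat.card {x // f x = 0} : ℤ) - Nat.card {x // f x = 1} := by
  classical
  have h : ∀ a : ZMod 2, sg a = (if a = 0 then 1 else 0) - (if a = 1 then 1 else 0) := by decide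
  simp_rw [h, Finset.sum_sub_distrib, Nat.card_eq_fintype_card, Fintype.card_subtype,
    Finset.sum_boole]

section tower
variable {K L : Type*} [Field K] [Fintype K] [Algebra (ZMod 2) K] [Field L] [Fintype L]
  [Algebra (ZMod 2) L] [Algebra K L] [IsScalarTower (ZMod 2) K L]

lemma trace_tower (hodd : Odd (Module.finrank K L)) (y : K) :
    Algebra.trace (ZMod 2) L (algebraMap K L y) = Algebra.trace (ZMod 2) K y := by
  rw [← Algebra.trace_trace (S := K), Algebra.trace_algebraMap, map_nsmul, nsmul_eq_mul,
    (ZMod.natCast_eq_one_iff_odd).mpr hodd, one_mul]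

lemma card_fiber_mod (p : ℕ) [Fact p.Prime] (hp : Module.finrank K L = p) (T : L → ZMod 2)
    (hT : ∀ (σ : Gal(L/K)) x, T (σ x) = T x) (a : ZMod 2) :
    Nat.card {x // T x = a} ≡ Nat.card {y : K // T (algebraMap K L y) = a} [MOD p] := by
  have hG : IsPGroup p Gal(L/K) := by
    apply IsPGroup.of_card (n := 1)
    rw [IsGalois.card_aut_eq_finrank, hp, pow_one]
  letI : MulAction Gal(L/K) {x // T x = a} :=
    { smul := fun σ x => ⟨σ x.1, by rw [hT]; exact x.2⟩
      one_smul := fun x => rfl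
      mul_smul := fun σ τ x => rfl }
  have h := hG.card_modEq_card_fixedPoints {x // T x = a}
  refine h.trans ?_
  have e : Nat.card {y : K // T (algebraMap K L y) = a} =
      Nat.card (MulAction.fixedPoints Gal(L/K) {x // T x = a}) := by
    apply Nat.card_congr
    apply Equiv.ofBijective
      (fun y => (⟨⟨algebraMap K L y.1, y.2⟩, fun σ => Subtype.ext (σ.commutes y.1)⟩ :
        MulAction.fixedPoints Gal(L/K) {x // T x = a}))
    constructor
    · intro y y' hy
      have h1 := congrArg (fun z => z.1.1) hy
      exact Subtype.ext ((algebraMap K L).injective h1)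
    · rintro ⟨⟨x, hx⟩, hfix⟩
      have hb : x ∈ (⊥ : IntermediateField K L) := by
        rw [IsGalois.mem_bot_iff_fixed]
        intro σ
        exact congrArg Subtype.val (hfix σ)
      obtain ⟨y, hy⟩ := IntermediateField.mem_bot.mp hb
      refine ⟨⟨y, by rw [hy]; exact hx⟩, ?_⟩
      apply Subtype.ext
      apply Subtype.ext
      exact hy
  rw [e]

lemma gsum_mod (u p : ℕ) [Fact p.Prime] (hp : Module.finrank K L = p) (hodd : Odd p) :
    gsum L u 1 ≡ gsum K u 1 [ZMOD p] := by
  set T : L → ZMod 2 := fun x => Algebra.trace (ZMod 2) L (x ^ (2 ^ u + 1)) +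
    Algebra.trace (ZMod 2) L (1 * x) with hTdef
  have hT : ∀ (σ : Gal(L/K)) x, T (σ x) = T x := by
    intro σ x
    have h := fun z => Algebra.trace_eq_of_algEquiv (AlgEquiv.restrictScalars (ZMod 2) σ) z
    simp only [AlgEquiv.restrictScalars_apply] at h
    simp only [hTdef, one_mul]
    rw [← map_pow, h, h]
  have hK : ∀ y : K, T (algebraMap K L y) = Algebra.trace (ZMod 2) K (y ^ (2 ^ u + 1)) +
    Algebra.trace (ZMod 2) K (1 * y) := by
    intro y
    simp only [hTdef, one_mul]
    rw [← map_pow, trace_tower (hp ▸ hodd), trace_tower (hp ▸ hodd)]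
  have e1 : gsum L u 1 = ∑ x, sg (T x) := rfl
  have e2 : gsum K u 1 = ∑ y : K, sg (T (algebraMap K L y)) := by
    simp only [hK]; rfl
  rw [e1, e2, sum_sg_eq_card, sum_sg_eq_card]
  exact Int.ModEq.sub (Int.natCast_modEq_iff.mpr (card_fiber_mod p hp T hT 0))
    (Int.natCast_modEq_iff.mpr (card_fiber_mod p hp T hT 1))

end tower

lemma gsum_one_sq {F : Type*} [Field F] [Fintype F] [Algebra (ZMod 2) F] (u m : ℕ)
    (hm : Fintype.card F = 2 ^ m) (hodd : Odd m) (hu : Nat.gcd u m = 1) (b : F)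
    (hb : Algebra.trace (ZMod 2) F b = 1) :
    gsum F u b = 2 ^ ((m + 1) / 2) ∨ gsum F u b = - 2 ^ ((m + 1) / 2) := by
  apply sq_eq_sq_iff_eq_or_eq_neg.mp
  rw [gsum_sq u m hm hodd hu, hb, sg_one, ← pow_mul]
  obtain ⟨k, rfl⟩ := hodd
  have : (2 * k + 1 + 1) / 2 * 2 = 2 * k + 1 + 1 := by omega
  rw [this, pow_succ _ (2 * k + 1)]
  norm_num

lemma sign_step (p m' : ℕ) [Fact p.Prime] (hpo : Odd p) (hmo : Odd m') (ε : ℤ)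
    (hε : ε = 1 ∨ ε = -1)
    (hmod : ε * 2 ^ ((p * m' + 1) / 2) ≡ jacobiSym 2 m' * 2 ^ ((m' + 1) / 2) [ZMOD p]) :
    ε = jacobiSym 2 (p * m') := by
  have hp : p.Prime := Fact.out
  haveI : NeZero p := ⟨hp.ne_zero⟩
  haveI : NeZero m' := ⟨hmo.pos.ne'⟩
  rw [jacobiSym.mul_right, ← jacobiSym.legendreSym.to_jacobiSym]
  have h2 : (2 : ZMod p) ≠ 0 := by
    intro h
    have h' : ((2 : ℕ) : ZMod p) = 0 := by exact_mod_cast h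
    rw [ZMod.natCast_eq_zero_iff] at h'
    have := (Nat.prime_dvd_prime_iff_eq hp Nat.prime_two).mp h'
    subst this
    exact absurd hpo (by decide)
  have hL : legendreSym p 2 = 1 ∨ legendreSym p 2 = -1 :=
    legendreSym.eq_one_or_neg_one p (by exact_mod_cast h2)
  have hJ : jacobiSym 2 m' = 1 ∨ jacobiSym 2 m' = -1 :=
    jacobiSym.eq_one_or_neg_one (by
      have : Nat.Coprime 2 m' := Nat.coprime_two_left.mpr hmo
      simpa [Int.gcd] using this)
  have hexp : (p * m' + 1) / 2 = (m' + 1) / 2 + p / 2 * m' := by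
    obtain ⟨a, rfl⟩ := hpo
    obtain ⟨b, rfl⟩ := hmo
    have e1 : ((2 * a + 1) * (2 * b + 1) + 1) = 2 * ((b + 1) + a * (2 * b + 1)) := by ring
    have e2 : (2 * a + 1) / 2 = a := by omega
    have e3 : (2 * b + 1 + 1) / 2 = b + 1 := by omega
    rw [e1, e2, e3, Nat.mul_div_cancel_left _ (by norm_num)]
  have hLe := legendreSym.eq_pow p 2
  have hm := (ZMod.intCast_eq_intCast_iff _ _ p).mpr hmod
  push_cast at hm hLe
  rw [hexp, pow_add, pow_mul, ← hLe] at hm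
  have hm2 : (ε : ZMod p) * (legendreSym p 2 : ZMod p) ^ m' = (jacobiSym 2 m' : ZMod p) := by
    apply mul_right_cancel₀ (pow_ne_zero ((m' + 1) / 2) h2)
    rw [← hm]; ring
  have hne : (1 : ZMod p) ≠ -1 := by
    intro h
    apply h2
    linear_combination h
  rcases hε with rfl | rfl <;> rcases hL with hL | hL <;> rcases hJ with hJ | hJ <;>
    rw [hL, hJ] at hm2 ⊢ <;> simp [hmo.neg_one_pow] at hm2 ⊢ <;>
    first | exact hne hm2 | exact hne hm2.symm

theorem gsum_one (m : ℕ) : ∀ (F : Type) [Field F] [Fintype F] [Algebra (ZMod 2) F] (u : ℕ)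
    (_ : Fintype.card F = 2 ^ m) (_ : Odd m) (_ : Nat.gcd u m = 1),
    gsum F u 1 = jacobiSym 2 m * 2 ^ ((m + 1) / 2) := by
  induction m using Nat.strong_induction_on with
  | _ m ih =>
  intro F _ _ _ u hm hodd hu
  by_cases h1 : m = 1
  · subst h1
    have hz : ∀ x : F, x = 0 ∨ x = 1 := fun x => fixed_two 1 1 hm rfl x (by
      have := FiniteField.pow_card x
      rwa [hm] at this)
    classical
    have huniv : (Finset.univ : Finset F) = {0, 1} := by
      ext x; simpa using hz x
    rw [gsum, huniv, Finset.sum_pair zero_ne_one]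
    simp [sg_zero, trace_one_eq 1 hm hodd, sg_add, sg_one]
  · obtain ⟨p, hp, m', rfl⟩ : ∃ p, p.Prime ∧ ∃ m', m = p * m' :=
      ⟨m.minFac, Nat.minFac_prime h1, Nat.minFac_dvd m⟩
    haveI : Fact p.Prime := ⟨hp⟩
    obtain ⟨hpo, hmo⟩ := Nat.odd_mul.mp hodd
    have hm0 : 0 < m' := hmo.pos
    haveI : NeZero p := ⟨hp.ne_zero⟩
    haveI : NeZero m' := ⟨hm0.ne'⟩
    have hum : Nat.gcd u m' = 1 := Nat.Coprime.coprime_dvd_right (dvd_mul_left _ _) hu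
    have hfF : Module.finrank (ZMod 2) F = p * m' := by
      rw [card_eq_two_pow_finrank] at hm
      exact Nat.pow_right_injective le_rfl hm
    have hfK : Module.finrank (ZMod 2) (GaloisField 2 m') = m' := GaloisField.finrank 2 hm0.ne'
    obtain ⟨f⟩ := FiniteField.nonempty_algHom_of_finrank_dvd (F := ZMod 2)
      (K := GaloisField 2 m') (L := F) (by rw [hfF, hfK]; exact dvd_mul_left _ _)
    letI : Algebra (GaloisField 2 m') F := f.toRingHom.toAlgebra
    haveI : IsScalarTower (ZMod 2) (GaloisField 2 m') F :=
      IsScalarTower.of_algebraMap_eq' f.comp_algebraMap.symm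
    letI : Fintype (GaloisField 2 m') := Fintype.ofFinite _
    have hfKL : Module.finrank (GaloisField 2 m') F = p := by
      have h := Module.finrank_mul_finrank (ZMod 2) (GaloisField 2 m') F
      rw [hfK, hfF, mul_comm] at h
      exact Nat.eq_of_mul_eq_mul_right hm0 h
    have hmod := gsum_mod (K := GaloisField 2 m') (L := F) u p hfKL hpo
    have hlt : m' < p * m' := by nlinarith [hp.two_le]
    rw [ih m' hlt (GaloisField 2 m') u (by rw [card_eq_two_pow_finrank, hfK]) hmo hum] at hmod
    have hsq := gsum_one_sq u (p * m') hm hodd hu (1 : F) (trace_one_eq _ hm hodd)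
    obtain ⟨ε, hε, hε'⟩ : ∃ ε : ℤ, (ε = 1 ∨ ε = -1) ∧ gsum F u 1 = ε * 2 ^ ((p * m' + 1) / 2) := by
      rcases hsq with h | h
      · exact ⟨1, Or.inl rfl, by rw [h, one_mul]⟩
      · exact ⟨-1, Or.inr rfl, by rw [h]; ring⟩
    rw [hε'] at hmod ⊢
    rw [sign_step p m' hpo hmo ε hε hmod]

section defset
variable {F : Type} [Field F] [Fintype F] [Algebra (ZMod 2) F]

lemma four_mul_charSum (u : ℕ) (ρ : ZMod 2) (D : Set F) [Fintype D]
    (hD : ∀ x, x ∈ D ↔ Algebra.trace (ZMod 2) F x = 1 ∧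
      Algebra.trace (ZMod 2) F (x ^ (2 ^ u + 1)) = ρ) (b : F) :
    4 * ∑ i : D, sg (Algebra.trace (ZMod 2) F (b * i)) =
      (∑ x : F, sg (Algebra.trace (ZMod 2) F (x * b)))
      - (∑ x : F, sg (Algebra.trace (ZMod 2) F (x * (b + 1))))
      + sg ρ * (gsum F u b - gsum F u (b + 1)) := by
  classical
  have h : ∀ x : F, (if x ∈ D then 4 * sg (Algebra.trace (ZMod 2) F (b * x)) else 0) =
      sg (Algebra.trace (ZMod 2) F (x * b)) - sg (Algebra.trace (ZMod 2) F (x * (b + 1)))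
      + sg ρ * (sg (Algebra.trace (ZMod 2) F (x ^ (2 ^ u + 1)) + Algebra.trace (ZMod 2) F (b * x))
      - sg (Algebra.trace (ZMod 2) F (x ^ (2 ^ u + 1)) +
        Algebra.trace (ZMod 2) F ((b + 1) * x))) := by
    intro x
    rw [mul_comm x b, mul_comm x (b + 1), add_mul, one_mul, map_add, hD]
    generalize Algebra.trace (ZMod 2) F (b * x) = s
    generalize Algebra.trace (ZMod 2) F x = t
    generalize Algebra.trace (ZMod 2) F (x ^ (2 ^ u + 1)) = w
    clear hD
    have hh : ∀ a : ZMod 2, a = 0 ∨ a = 1 := z2_cases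
    have e11 : (1 : ZMod 2) + 1 = 0 := by decide
    rcases hh s with rfl | rfl <;> rcases hh t with rfl | rfl <;> rcases hh w with rfl | rfl <;>
      rcases hh ρ with rfl | rfl <;> simp [sg_zero, sg_one, e11]
  have e : ∑ i : D, 4 * sg (Algebra.trace (ZMod 2) F (b * i)) =
      ∑ x : F, if x ∈ D then 4 * sg (Algebra.trace (ZMod 2) F (b * x)) else 0 := by
    rw [← Finset.sum_filter]
    symm
    apply Finset.sum_subtype
    simp
  rw [Finset.mul_sum, e, Finset.sum_congr rfl (fun x _ => h x)]
  simp only [Finset.sum_add_distrib, Finset.sum_sub_distrib, ← Finset.mul_sum, gsum]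

lemma gsum_zero_of_trace (u m : ℕ) (hm : Fintype.card F = 2 ^ m) (hodd : Odd m)
    (hu : Nat.gcd u m = 1) (b : F) (hb : Algebra.trace (ZMod 2) F b = 0) : gsum F u b = 0 := by
  have := gsum_sq u m hm hodd hu b
  rw [hb, sg_zero, sub_self, mul_zero] at this
  exact pow_eq_zero_iff (two_ne_zero) |>.mp this

lemma charSum_values (u m : ℕ) (hm : Fintype.card F = 2 ^ m) (h5 : 5 ≤ m) (hodd : Odd m)
    (hu : Nat.gcd u m = 1) (ρ : ZMod 2) (D : Set F) [Fintype D]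
    (hD : ∀ x, x ∈ D ↔ Algebra.trace (ZMod 2) F x = 1 ∧
      Algebra.trace (ZMod 2) F (x ^ (2 ^ u + 1)) = ρ) (b : F) (hb0 : b ≠ 0) (hb1 : b ≠ 1) :
    ∑ i : D, sg (Algebra.trace (ZMod 2) F (b * i)) = 2 ^ ((m - 3) / 2) ∨
    ∑ i : D, sg (Algebra.trace (ZMod 2) F (b * i)) = - 2 ^ ((m - 3) / 2) := by
  haveI : CharP F 2 := charP_two
  have h := four_mul_charSum u ρ D hD b
  rw [sum_sg_trace b hb0, sum_sg_trace (b + 1) (by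
    intro h; exact hb1 (CharTwo.add_eq_zero.mp h))] at h
  have hpow : (2 : ℤ) ^ ((m + 1) / 2) = 4 * 2 ^ ((m - 3) / 2) := by
    have : (m + 1) / 2 = (m - 3) / 2 + 2 := by omega
    rw [this, pow_add]; ring
  have ht : Algebra.trace (ZMod 2) F (b + 1) = Algebra.trace (ZMod 2) F b + 1 := by
    rw [map_add, trace_one_eq m hm hodd]
  rcases z2_cases (Algebra.trace (ZMod 2) F b) with hb | hb
  · rw [gsum_zero_of_trace u m hm hodd hu b hb] at h
    rw [hb, zero_add] at ht
    have h1 := gsum_one_sq u m hm hodd hu (b + 1) ht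
    rw [hpow] at h1
    rcases sg_cases ρ with hr | hr <;> rw [hr] at h <;> omega
  · have h11 : (1 : ZMod 2) + 1 = 0 := by decide
    rw [hb, h11] at ht
    rw [gsum_zero_of_trace u m hm hodd hu (b + 1) ht] at h
    have h1 := gsum_one_sq u m hm hodd hu b hb
    rw [hpow] at h1
    rcases sg_cases ρ with hr | hr <;> rw [hr] at h <;> omega

lemma jac_val (m : ℕ) (hodd : Odd m) (ρ : ZMod 2)
    (hρ : (Even ((m ^ 2 - 1) / 8) ∧ ρ = 1) ∨ (Odd ((m ^ 2 - 1) / 8) ∧ ρ = 0)) :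
    sg ρ * jacobiSym 2 m = -1 := by
  rw [jacobiSym.at_two hodd, ZMod.χ₈_nat_eq_if_mod_eight]
  have hk : m = 8 * (m / 8) + m % 8 := by omega
  have hm2 : m % 2 = 1 := Nat.odd_iff.mp hodd
  set k := m / 8
  have h8 : m % 8 = 1 ∨ m % 8 = 3 ∨ m % 8 = 5 ∨ m % 8 = 7 := by omega
  have key : ∀ c t : ℕ, m % 8 = c → c ^ 2 = 8 * t + 1 →
      (m ^ 2 - 1) / 8 = 2 * (4 * k ^ 2 + k * c) + t := by
    intro c t hc ht
    rw [hc] at hk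
    have : m ^ 2 = 8 * (2 * (4 * k ^ 2 + k * c) + t) + 1 := by
      rw [hk]; linear_combination ht
    omega
  have hpar : ∀ c t : ℕ, m % 8 = c → c ^ 2 = 8 * t + 1 → ((m ^ 2 - 1) / 8) % 2 = t % 2 := by
    intro c t hc ht
    rw [key c t hc ht]; omega
  rw [Nat.even_iff, Nat.odd_iff] at hρ
  rcases h8 with h | h | h | h
  · have := hpar 1 0 h rfl
    rcases hρ with ⟨h1, rfl⟩ | ⟨h1, rfl⟩
    · simp [h, hm2, sg_one]
    · omega
  · have := hpar 3 1 h rfl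
    rcases hρ with ⟨h1, rfl⟩ | ⟨h1, rfl⟩
    · omega
    · simp [h, hm2, sg_zero]
  · have := hpar 5 3 h rfl
    rcases hρ with ⟨h1, rfl⟩ | ⟨h1, rfl⟩
    · omega
    · simp [h, hm2, sg_zero]
  · have := hpar 7 6 h rfl
    rcases hρ with ⟨h1, rfl⟩ | ⟨h1, rfl⟩
    · simp [h, hm2, sg_one]
    · omega

lemma card_defset (u m : ℕ) (hm : Fintype.card F = 2 ^ m) (h5 : 5 ≤ m) (hodd : Odd m)
    (hu : Nat.gcd u m = 1) (ρ : ZMod 2)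
    (hρ : (Even ((m ^ 2 - 1) / 8) ∧ ρ = 1) ∨ (Odd ((m ^ 2 - 1) / 8) ∧ ρ = 0))
    (D : Set F) [Fintype D]
    (hD : ∀ x, x ∈ D ↔ Algebra.trace (ZMod 2) F x = 1 ∧
      Algebra.trace (ZMod 2) F (x ^ (2 ^ u + 1)) = ρ) :
    Fintype.card D = 2 ^ (m - 2) + 2 ^ ((m - 3) / 2) := by
  have h := four_mul_charSum u ρ D hD 0
  rw [gsum_zero_of_trace u m hm hodd hu 0 (map_zero _), zero_add, sum_sg_trace 1 one_ne_zero,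
    gsum_one m F u hm hodd hu] at h
  simp only [zero_mul, mul_zero, map_zero, sg_zero, Finset.sum_const, Finset.card_univ, hm,
    nsmul_eq_mul, mul_one, sub_zero, zero_sub] at h
  have hj := jac_val m hodd ρ hρ
  have hpow : (2 : ℤ) ^ ((m + 1) / 2) = 4 * 2 ^ ((m - 3) / 2) := by
    have : (m + 1) / 2 = (m - 3) / 2 + 2 := by omega
    rw [this, pow_add]; ring
  have hpow2 : (2 : ℤ) ^ m = 4 * 2 ^ (m - 2) := by
    have : m = (m - 2) + 2 := by omega
    conv_lhs => rw [this, pow_add]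
    ring
  have h' : (4 : ℤ) * Fintype.card D = 4 * (2 ^ (m - 2) + 2 ^ ((m - 3) / 2)) := by
    push_cast at h
    rw [h, hpow2, hpow]
    linear_combination -(4 * 2 ^ ((m - 3) / 2)) * hj
  have h'' := mul_left_cancel₀ (by norm_num) h'
  exact_mod_cast h''

end defset

section coding
open Polynomial
variable {ι : Type*} [Fintype ι] [DecidableEq ι]

/-- Generating polynomial of signed vectors whose support contains `S`. -/
noncomputable def genPoly (S : Finset ι) (χ : ι → ℤ) : ℤ[X] :=
  ∏ i, if i ∈ S then C (χ i) * X else 1 + C (χ i) * X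

lemma wt_eq_card (x : ι → ZMod 2) : wt x = (Finset.univ.filter fun i => x i ≠ 0).card := by
  rw [wt, Nat.card_eq_fintype_card, Fintype.card_subtype]

lemma sum_zmod2 {M : Type*} [AddCommMonoid M] (f : ZMod 2 → M) : ∑ a, f a = f 0 + f 1 :=
  Fin.sum_univ_two f

lemma genPoly_eq (S : Finset ι) (c : ι → ZMod 2) :
    genPoly S (fun i => sg (c i)) = ∑ x : ι → ZMod 2,
      (if ∀ i ∈ S, x i ≠ 0 then X ^ wt x else 0) * C (sg (∑ i, x i * c i)) := by
  have h1 : genPoly S (fun i => sg (c i)) = ∏ i, ∑ a : ZMod 2,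
      (if a = 0 then (if i ∈ S then 0 else 1) else X) * C (sg (a * c i)) := by
    apply Finset.prod_congr rfl
    intro i _
    rw [sum_zmod2]
    by_cases hi : i ∈ S <;> simp [hi, sg_zero, mul_comm]
  rw [h1, Finset.prod_univ_sum, Fintype.piFinset_univ]
  apply Finset.sum_congr rfl
  intro x _
  rw [Finset.prod_mul_distrib, sg_sum, map_prod]
  congr 1
  split_ifs with h
  · rw [wt_eq_card, ← Finset.prod_const, Finset.prod_filter]
    apply Finset.prod_congr rfl
    intro i _
    by_cases hx : x i = 0
    · have : i ∉ S := fun hi => h i hi hx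
      simp [hx, this]
    · simp [hx]
  · push Not at h
    obtain ⟨i, hi, hx⟩ := h
    apply Finset.prod_eq_zero (Finset.mem_univ i)
    simp [hi, hx]

lemma macwilliams {B : Type*} [AddCommGroup B] [Fintype B] (c : B → ι → ZMod 2)
    (hadd : ∀ b b' i, c (b + b') i = c b i + c b' i) (Dl : Set (ι → ZMod 2))
    (hDl : ∀ x, x ∈ Dl ↔ ∀ b, ∑ i, x i * c b i = 0) (S : Finset ι) (w : ℕ) :
    (Fintype.card B : ℤ) * Nat.card {x // x ∈ Dl ∧ wt x = w ∧ ∀ i ∈ S, x i ≠ 0} =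
      ∑ b, (genPoly S (fun i => sg (c b i))).coeff w := by
  classical
  simp_rw [genPoly_eq, finsetSum_coeff, coeff_mul_C]
  rw [Finset.sum_comm]
  simp_rw [← Finset.mul_sum]
  have hs : ∀ x : ι → ZMod 2, ∑ b, sg (∑ i, x i * c b i) =
      if x ∈ Dl then (Fintype.card B : ℤ) else 0 := by
    intro x
    split_ifs with h
    · rw [hDl] at h
      simp [h, sg_zero]
    · rw [hDl] at h
      push Not at h
      let f : B →+ ZMod 2 := AddMonoidHom.mk' (fun b => ∑ i, x i * c b i) (by
        intro a b
        simp only [hadd, mul_add, Finset.sum_add_distrib])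
      exact sum_sg_zero f h
  simp_rw [hs]
  rw [Nat.card_eq_fintype_card, Fintype.card_subtype, Finset.card_filter, Nat.cast_sum,
    Finset.mul_sum]
  apply Finset.sum_congr rfl
  intro x _
  by_cases h1 : x ∈ Dl
  · by_cases h2 : ∀ i ∈ S, x i ≠ 0
    · rw [if_pos h2, if_pos h1, coeff_X_pow]
      by_cases h3 : wt x = w
      · rw [if_pos ⟨h1, h3, h2⟩, if_pos h3.symm]; simp
      · rw [if_neg (fun h => h3 h.2.1), if_neg (fun h => h3 h.symm)]; simp
    · simp [h1, h2]
  · simp [h1]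

lemma genPoly_smul (S : Finset ι) (χ : ι → ℤ) (η : ℤ) :
    genPoly S (fun i => η * χ i) = (genPoly S χ).comp (C η * X) := by
  rw [genPoly, genPoly, Polynomial.prod_comp]
  apply Finset.prod_congr rfl
  intro i _
  split_ifs <;> simp <;> ring

lemma genPoly_smul_coeff (S : Finset ι) (χ : ι → ℤ) (η : ℤ) (hη : η = 1 ∨ η = -1) (r : ℕ) :
    (genPoly S (fun i => η * χ i)).coeff (2 * r) = (genPoly S χ).coeff (2 * r) := by
  rw [genPoly_smul, comp_C_mul_X_coeff, pow_mul]
  rcases hη with rfl | rfl <;> simp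

lemma genPoly_empty (χ : ι → ℤ) (hχ : ∀ i, χ i = 1 ∨ χ i = -1) (d e : ℕ)
    (hn : Fintype.card ι = 2 * d + e) (hs : ∑ i, χ i = e) :
    genPoly ∅ χ = (1 - X) ^ d * (1 + X) ^ (d + e) := by
  have h1 : genPoly ∅ χ = ∏ i, if χ i = -1 then (1 - X : ℤ[X]) else 1 + X := by
    apply Finset.prod_congr rfl
    intro i _
    rcases hχ i with h | h <;> simp [h, sub_eq_add_neg]
  have h2 : ∑ i, χ i = ∑ i, ((1 : ℤ) - 2 * if χ i = -1 then 1 else 0) := by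
    apply Finset.sum_congr rfl
    intro i _
    rcases hχ i with h | h <;> simp [h]
  rw [hs, Finset.sum_sub_distrib, ← Finset.mul_sum, Finset.sum_boole] at h2
  simp only [Finset.sum_const, Finset.card_univ, hn, nsmul_eq_mul] at h2
  have h3 : (Finset.univ.filter fun i => χ i = -1).card = d := by
    push_cast at h2; omega
  have h4 := Finset.card_filter_add_card_filter_not (s := (Finset.univ : Finset ι)) (fun i => χ i = -1)
  rw [h3, Finset.card_univ, hn] at h4
  rw [h1, Finset.prod_ite, Finset.prod_const, Finset.prod_const, h3]
  congr 2
  omega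

lemma genPoly_pair (χ : ι → ℤ) (hχ : ∀ i, χ i = 1 ∨ χ i = -1) (p q : ι) (hpq : p ≠ q) :
    genPoly {p, q} χ = (X ^ 2 * genPoly ∅ χ) /ₘ ((X + C (χ p)) * (X + C (χ q))) := by
  have hmon : ((X + C (χ p)) * (X + C (χ q))).Monic := (monic_X_add_C _).mul (monic_X_add_C _)
  have hcc : ∀ i, (C (χ i) : ℤ[X]) * C (χ i) = 1 := by
    intro i
    rw [← C_mul]
    rcases hχ i with h | h <;> simp [h]
  have key : X ^ 2 * genPoly ∅ χ = ((X + C (χ p)) * (X + C (χ q))) * genPoly {p, q} χ := by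
    have hsplit : ∀ f : ι → ℤ[X], ∏ i, f i = f p * (f q * ∏ i ∈ ((Finset.univ.erase p).erase q), f i) := by
      intro f
      rw [← Finset.mul_prod_erase _ _ (Finset.mem_univ p),
        ← Finset.mul_prod_erase (Finset.univ.erase p) _ (Finset.mem_erase.mpr ⟨hpq.symm, Finset.mem_univ q⟩)]
    rw [genPoly, genPoly, hsplit, hsplit]
    have hrest : ∏ i ∈ ((Finset.univ.erase p).erase q),
        (if i ∈ (∅ : Finset ι) then C (χ i) * X else 1 + C (χ i) * X) =
        ∏ i ∈ ((Finset.univ.erase p).erase q),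
        (if i ∈ ({p, q} : Finset ι) then C (χ i) * X else 1 + C (χ i) * X) := by
      apply Finset.prod_congr rfl
      intro i hi
      simp only [Finset.mem_erase] at hi
      simp [hi.1, hi.2.1]
    rw [hrest]
    generalize ∏ i ∈ ((Finset.univ.erase p).erase q),
        (if i ∈ ({p, q} : Finset ι) then C (χ i) * X else 1 + C (χ i) * X) = R
    simp only [Finset.notMem_empty, if_false, Finset.mem_insert, Finset.mem_singleton, true_or,
      or_true, if_true]
    have e : ∀ i, X * (1 + C (χ i) * X) = (X + C (χ i)) * (C (χ i) * X) := by
      intro i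
      linear_combination (-X : ℤ[X]) * hcc i
    linear_combination (X * (1 + C (χ q) * X) * R) * e p + ((X + C (χ p)) * (C (χ p) * X) * R) * e q
  rw [key, mul_divByMonic_cancel_left _ hmon]

/-- Hypotheses on the code used in the counting argument. -/
structure CodeData {B : Type*} [AddCommGroup B] [Fintype B] (c : B → ι → ZMod 2) (o : B)
    (d e : ℕ) : Prop where
  add : ∀ b b' i, c (b + b') i = c b i + c b' i
  o_ne : o ≠ 0
  one : ∀ i, c o i = 1
  card : Fintype.card ι = 2 * d + e
  epos : 0 < e
  sums : ∀ b, b ≠ 0 → b ≠ o → ∑ i, sg (c b i) = e ∨ ∑ i, sg (c b i) = -e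
  orth : ∀ p q, p ≠ q → ∃ b, c b p ≠ c b q

variable {B : Type*} [AddCommGroup B] [Fintype B] [DecidableEq B] {c : B → ι → ZMod 2} {o : B}
  {d e : ℕ}

lemma CodeData.zero (h : CodeData c o d e) (i : ι) : c 0 i = 0 := by
  have := h.add 0 0 i
  rw [add_zero] at this
  exact left_eq_add.mp this

lemma CodeData.split (h : CodeData c o d e) (f : B → ℤ) :
    ∑ b, f b = f 0 + f o + ∑ b ∈ Finset.univ.filter (fun b => b ≠ 0 ∧ b ≠ o), f b := by
  rw [← Finset.add_sum_erase _ _ (Finset.mem_univ (0 : B)),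
    ← Finset.add_sum_erase (Finset.univ.erase 0) _ (by simp [h.o_ne] : o ∈ _), add_assoc]
  congr 2
  apply Finset.sum_congr _ (fun _ _ => rfl)
  ext b; simp [and_comm]

lemma CodeData.eta (h : CodeData c o d e) (b : B) (hb : b ≠ 0 ∧ b ≠ o) :
    ∃ η : ℤ, (η = 1 ∨ η = -1) ∧ ∑ i, η * sg (c b i) = e ∧ ∑ i, sg (c b i) = η * e := by
  rcases h.sums b hb.1 hb.2 with h1 | h1
  · exact ⟨1, Or.inl rfl, by simpa using h1, by simpa using h1⟩
  · exact ⟨-1, Or.inr rfl, by simp [h1], by simp [h1]⟩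

lemma CodeData.ends (h : CodeData c o d e) (S : Finset ι) (r : ℕ) :
    (genPoly S (fun i => sg (c 0 i))).coeff (2 * r) = (genPoly S (fun _ => 1)).coeff (2 * r) ∧
    (genPoly S (fun i => sg (c o i))).coeff (2 * r) = (genPoly S (fun _ => 1)).coeff (2 * r) := by
  constructor
  · simp [h.zero, sg_zero]
  · have := genPoly_smul_coeff S (fun _ => 1) (-1) (Or.inr rfl) r
    simpa [h.one, sg_one] using this

lemma sg_mul_pm (η : ℤ) (hη : η = 1 ∨ η = -1) (a : ZMod 2) : η * sg a = 1 ∨ η * sg a = -1 := by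
  rcases hη with rfl | rfl <;> rcases sg_cases a with h | h <;> simp [h]

lemma genPoly_one_empty (n : ℕ) (hn : Fintype.card ι = n) (k : ℕ) :
    (genPoly (∅ : Finset ι) (fun _ => 1)).coeff k = n.choose k := by
  have : genPoly (∅ : Finset ι) (fun _ => 1) = (1 + X) ^ n := by
    simp [genPoly, hn]
  rw [this, coeff_one_add_X_pow]

lemma CodeData.count (h : CodeData c o d e) (m : ℕ) (hB : Fintype.card B = 2 ^ m) (hm : 0 < m)
    (Dl : Set (ι → ZMod 2)) (hDl : ∀ x, x ∈ Dl ↔ ∀ b, ∑ i, x i * c b i = 0) (r : ℕ) :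
    (2 : ℤ) ^ (m - 1) * weightCount Dl (2 * r) = ((2 * d + e).choose (2 * r) : ℤ) +
      ((2 : ℤ) ^ (m - 1) - 1) * (((1 - X) ^ d * (1 + X) ^ (d + e) : ℤ[X]).coeff (2 * r)) := by
  have h1 := macwilliams c h.add Dl hDl ∅ (2 * r)
  have h2 : Nat.card {x // x ∈ Dl ∧ wt x = 2 * r ∧ ∀ i ∈ (∅ : Finset ι), x i ≠ 0} =
      weightCount Dl (2 * r) := by
    simp [weightCount]
  rw [h2, h.split, (h.ends ∅ r).1, (h.ends ∅ r).2, genPoly_one_empty _ h.card, hB] at h1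
  have h3 : ∀ b ∈ Finset.univ.filter (fun b => b ≠ 0 ∧ b ≠ o),
      (genPoly ∅ (fun i => sg (c b i))).coeff (2 * r) =
      ((1 - X) ^ d * (1 + X) ^ (d + e) : ℤ[X]).coeff (2 * r) := by
    intro b hb
    obtain ⟨η, hη, hs, -⟩ := h.eta b (by simpa using hb)
    rw [← genPoly_smul_coeff ∅ _ η hη, genPoly_empty _ (fun i => sg_mul_pm η hη _) d e h.card hs]
  rw [Finset.sum_congr rfl h3] at h1
  have h4 := h.split (fun _ => 1)
  simp only [Finset.sum_const, Finset.card_univ, hB, nsmul_eq_mul, mul_one] at h1 h4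
  have hp : (2 : ℤ) ^ m = 2 * 2 ^ (m - 1) := by
    obtain ⟨k, rfl⟩ : ∃ k, m = k + 1 := ⟨m - 1, by omega⟩
    simp [pow_succ, mul_comm]
  push_cast at h1 h4
  rw [hp] at h1 h4
  have h5 : ((Finset.univ.filter (fun b : B => b ≠ 0 ∧ b ≠ o)).card : ℤ) = 2 * (2 ^ (m - 1) - 1) := by
    linarith
  rw [h5] at h1
  linarith

lemma bilin_interp (G : ℤ → ℤ → ℤ) : ∃ α β γ δ : ℤ, ∀ x y : ℤ, (x = 1 ∨ x = -1) →
    (y = 1 ∨ y = -1) → 4 * G x y = α + β * x + γ * y + δ * (x * y) := by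
  refine ⟨G 1 1 + G 1 (-1) + G (-1) 1 + G (-1) (-1), G 1 1 + G 1 (-1) - G (-1) 1 - G (-1) (-1),
    G 1 1 - G 1 (-1) + G (-1) 1 - G (-1) (-1), G 1 1 - G 1 (-1) - G (-1) 1 + G (-1) (-1), ?_⟩
  rintro x y (rfl | rfl) (rfl | rfl) <;> ring

lemma CodeData.orth_sum (h : CodeData c o d e) (p q : ι) (hpq : p ≠ q) :
    ∑ b, sg (c b p) * sg (c b q) = 0 := by
  let f : B →+ ZMod 2 := AddMonoidHom.mk' (fun b => c b p + c b q) (by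
    intro a b; simp only [h.add]; ring)
  have := sum_sg_zero f (by
    obtain ⟨b, hb⟩ := h.orth p q hpq
    refine ⟨b, fun h0 => hb ?_⟩
    exact CharTwo.add_eq_zero.mp h0)
  simp_rw [← sg_add]
  exact this

lemma CodeData.pair_const (h : CodeData c o d e)
    (Dl : Set (ι → ZMod 2)) (hDl : ∀ x, x ∈ Dl ↔ ∀ b, ∑ i, x i * c b i = 0) (r : ℕ) :
    ∃ K : ℤ, ∀ p q : ι, p ≠ q → 4 * e * ((Fintype.card B : ℤ) *
      Nat.card {x : ι → ZMod 2 // x ∈ Dl ∧ wt x = 2 * r ∧ x p ≠ 0 ∧ x q ≠ 0}) = K := by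
  obtain ⟨α, β, γ, δ, hG⟩ := bilin_interp (fun x y =>
    ((X ^ 2 * ((1 - X) ^ d * (1 + X) ^ (d + e)) : ℤ[X]) /ₘ ((X + C x) * (X + C y))).coeff (2 * r))
  let P1 : ℤ := ((X ^ 2 * genPoly (∅ : Finset ι) (fun _ => 1)) /ₘ
    ((X + C 1) * (X + C 1))).coeff (2 * r)
  refine ⟨8 * e * P1 + α * e * (Fintype.card B - 2) +
    (β + γ) * (Fintype.card B - 2 * (2 * d + e)) - 2 * δ * e, ?_⟩
  intro p q hpq
  have h1 := macwilliams c h.add Dl hDl {p, q} (2 * r)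
  have hset : Nat.card {x : ι → ZMod 2 // x ∈ Dl ∧ wt x = 2 * r ∧ x p ≠ 0 ∧ x q ≠ 0} =
      Nat.card {x // x ∈ Dl ∧ wt x = 2 * r ∧ ∀ i ∈ ({p, q} : Finset ι), x i ≠ 0} := by
    simp
  rw [hset, h1, h.split, (h.ends _ r).1, (h.ends _ r).2,
    genPoly_pair _ (fun _ => Or.inl rfl) p q hpq]
  have hterm : ∀ b ∈ Finset.univ.filter (fun b => b ≠ 0 ∧ b ≠ o),
      4 * e * (genPoly {p, q} (fun i => sg (c b i))).coeff (2 * r) =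
      α * e + β * ((∑ i, sg (c b i)) * sg (c b p)) + γ * ((∑ i, sg (c b i)) * sg (c b q))
        + δ * e * (sg (c b p) * sg (c b q)) := by
    intro b hb
    obtain ⟨η, hη, hs, hs2⟩ := h.eta b (by simpa using hb)
    have hpm := fun i => sg_mul_pm η hη (c b i)
    rw [← genPoly_smul_coeff _ _ η hη, genPoly_pair _ hpm p q hpq,
      genPoly_empty _ hpm d e h.card hs, hs2]
    have hg := hG _ _ (hpm p) (hpm q)
    have hηη : η * η = 1 := by rcases hη with rfl | rfl <;> norm_num
    beta_reduce at hg
    linear_combination (e : ℤ) * hg + δ * e * sg (c b p) * sg (c b q) * hηη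
  have hcardB := h.split (fun _ => 1)
  simp only [Finset.sum_const, Finset.card_univ, nsmul_eq_mul, mul_one] at hcardB
  have hS : ∀ p : ι, ∑ b ∈ Finset.univ.filter (fun b => b ≠ 0 ∧ b ≠ o),
      (∑ i, sg (c b i)) * sg (c b p) = Fintype.card B - 2 * (2 * d + e) := by
    intro p
    have hsp := h.split (fun b => (∑ i, sg (c b i)) * sg (c b p))
    have htot : ∑ b, (∑ i, sg (c b i)) * sg (c b p) = Fintype.card B := by
      simp_rw [Finset.sum_mul]
      rw [Finset.sum_comm, Finset.sum_eq_single p]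
      · simp [sg_sq]
      · intro i _ hi
        exact h.orth_sum i p hi
      · simp
    rw [htot] at hsp
    simp only [h.zero, h.one, sg_zero, sg_one, Finset.sum_const, Finset.card_univ, h.card,
      nsmul_eq_mul] at hsp
    push_cast at hsp
    linarith
  have hO : ∑ b ∈ Finset.univ.filter (fun b => b ≠ 0 ∧ b ≠ o), sg (c b p) * sg (c b q) = -2 := by
    have hsp := h.split (fun b => sg (c b p) * sg (c b q))
    rw [h.orth_sum p q hpq] at hsp
    simp only [h.zero, h.one, sg_zero, sg_one] at hsp
    linarith
  rw [mul_add, Finset.mul_sum, Finset.sum_congr rfl hterm]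
  simp only [Finset.sum_add_distrib, ← Finset.mul_sum, hS, hO, Finset.sum_const, nsmul_eq_mul]
  change 4 * (e : ℤ) * (P1 + P1) + _ = _
  linear_combination (-(α * e)) * hcardB

lemma double_count (Dl : Set (ι → ZMod 2)) (w lam : ℕ) (hD : HoldsTwoDesign Dl w lam) :
    lam * (Fintype.card ι * (Fintype.card ι - 1)) = w * (w - 1) * weightCount Dl w := by
  classical
  have key : ∑ pq ∈ (Finset.univ : Finset ι).offDiag,
      Nat.card {x : ι → ZMod 2 // x ∈ Dl ∧ wt x = w ∧ x pq.1 ≠ 0 ∧ x pq.2 ≠ 0} =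
      ∑ pq ∈ (Finset.univ : Finset ι).offDiag, lam := by
    apply Finset.sum_congr rfl
    intro pq hpq
    exact hD _ _ (Finset.mem_offDiag.mp hpq).2.2
  rw [Finset.sum_const, Finset.offDiag_card, Finset.card_univ, smul_eq_mul] at key
  have e1 : Fintype.card ι * (Fintype.card ι - 1) =
      Fintype.card ι * Fintype.card ι - Fintype.card ι := by
    rw [Nat.mul_sub, mul_one]
  rw [mul_comm, e1, ← key]
  simp_rw [Nat.card_eq_fintype_card, Fintype.card_subtype, Finset.card_filter]
  rw [Finset.sum_comm, weightCount, Nat.card_eq_fintype_card, Fintype.card_subtype,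
    Finset.card_filter, Finset.mul_sum]
  apply Finset.sum_congr rfl
  intro x _
  by_cases hx : x ∈ Dl ∧ wt x = w
  · simp only [hx, true_and, if_true, mul_one]
    rw [← Finset.card_filter]
    have : (Finset.univ : Finset ι).offDiag.filter (fun pq => x pq.1 ≠ 0 ∧ x pq.2 ≠ 0) =
        (Finset.univ.filter (fun i => x i ≠ 0)).offDiag := by
      ext pq
      simp [Finset.mem_offDiag]
      tauto
    rw [this, Finset.offDiag_card, ← wt_eq_card, hx.2, Nat.mul_sub, mul_one]
  · have : ∀ pq : ι × ι, ¬ (x ∈ Dl ∧ wt x = w ∧ x pq.1 ≠ 0 ∧ x pq.2 ≠ 0) := by tauto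
    simp [hx, this]

lemma CodeData.design (h : CodeData c o d e)
    (Dl : Set (ι → ZMod 2)) (hDl : ∀ x, x ∈ Dl ↔ ∀ b, ∑ i, x i * c b i = 0) (r : ℕ)
    (hn : 2 ≤ 2 * d + e) : ∃ lam, HoldsTwoDesign Dl (2 * r) lam := by
  obtain ⟨K, hK⟩ := h.pair_const Dl hDl r
  have : Nontrivial ι := Fintype.one_lt_card_iff_nontrivial.mp (by rw [h.card]; omega)
  obtain ⟨p0, q0, h0⟩ := exists_pair_ne ι
  refine ⟨Nat.card {x : ι → ZMod 2 // x ∈ Dl ∧ wt x = 2 * r ∧ x p0 ≠ 0 ∧ x q0 ≠ 0},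
    fun p q hpq => ?_⟩
  · have h1 := (hK p q hpq).trans (hK p0 q0 h0).symm
    have he : (4 * e : ℤ) ≠ 0 := by
      have := h.epos
      positivity
    have hc : (Fintype.card B : ℤ) ≠ 0 := by
      have : 0 < Fintype.card B := Fintype.card_pos
      positivity
    exact_mod_cast mul_left_cancel₀ hc (mul_left_cancel₀ he h1)

lemma coeff_formula (d e f r : ℕ) (he : e = 2 * f) :
    ((1 - X) ^ d * (1 + X) ^ (d + e) : ℤ[X]).coeff (2 * r) =
      ∑ p ∈ (Finset.range (d + 1) ×ˢ Finset.range (f + 1)).filter (fun p => p.1 + p.2 = r),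
            (-1 : ℤ) ^ p.1 * (d.choose p.1) * (e.choose (2 * p.2)) := by
  have h1 : ((1 - X) ^ d * (1 + X) ^ (d + e) : ℤ[X]) =
      ∑ i ∈ Finset.range (d + 1), C ((-1 : ℤ) ^ i * (d.choose i)) * (X ^ (2 * i) * (1 + X) ^ e) := by
    have : (1 - X : ℤ[X]) ^ d * (1 + X) ^ (d + e) = (-X ^ 2 + 1) ^ d * (1 + X) ^ e := by
      rw [pow_add, ← mul_assoc, ← mul_pow]; ring
    rw [this, add_pow, Finset.sum_mul]
    apply Finset.sum_congr rfl
    intro i _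
    simp only [neg_pow (X ^ 2 : ℤ[X]) i, C_mul, C_pow, C_neg, C_1, one_pow, map_natCast, pow_mul]
    ring
  rw [h1, finsetSum_coeff, Finset.sum_filter, Finset.sum_product]
  apply Finset.sum_congr rfl
  intro i _
  rw [coeff_C_mul, coeff_X_pow_mul']
  by_cases hir : i ≤ r
  · rw [if_pos (by omega), coeff_one_add_X_pow]
    have e2 : 2 * r - 2 * i = 2 * (r - i) := by omega
    rw [e2]
    by_cases hf : r - i ≤ f
    · rw [Finset.sum_eq_single (r - i)]
      · rw [if_pos (by omega)]
      · intro j _ hj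
        rw [if_neg (by omega)]
      · intro hj
        simp at hj
        omega
    · rw [Nat.choose_eq_zero_of_lt (by omega : e < 2 * (r - i)), Finset.sum_eq_zero]
      · simp
      · intro j hj
        simp at hj
        rw [if_neg (by omega)]
  · rw [if_neg (by omega), Finset.sum_eq_zero]
    · simp
    · intro j hj
      rw [if_neg (by omega)]

end coding

theorem dual_designs_from_codeD_plus (m u : ℕ) (hm : 5 ≤ m) (hmodd : Odd m) (hu : 0 < u)
    (hgcd : Nat.gcd u m = 1) (ρ : ZMod 2)
    (hρ : (Even ((m ^ 2 - 1) / 8) ∧ ρ = 1) ∨ (Odd ((m ^ 2 - 1) / 8) ∧ ρ = 0)) (n d : ℕ)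
    (hn : n = 2 ^ (m - 2) + 2 ^ ((m - 3) / 2)) (hd : d = 2 ^ (m - 3)) :
    ∀ r : ℕ, 2 ≤ r → 2 * r ≤ n - 2 →
      0 < weightCount (dualCode (codeD m u ρ : Set (↥(Dset m u ρ) → ZMod 2))) (2 * r) →
      (∃ lam : ℕ,
        HoldsTwoDesign (dualCode (codeD m u ρ : Set (↥(Dset m u ρ) → ZMod 2))) (2 * r) lam ∧
        lam * (n * (n - 1)) = 2 * r * (2 * r - 1) * weightCount (dualCode (codeD m u ρ : Set (↥(Dset m u ρ) → ZMod 2))) (2 * r)) ∧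
      (2 : ℤ) ^ (m - 1) * weightCount (dualCode (codeD m u ρ : Set (↥(Dset m u ρ) → ZMod 2))) (2 * r) =
        (n.choose (2 * r) : ℤ) + ((2 : ℤ) ^ (m - 1) - 1) *
          ∑ p ∈ (Finset.range (d + 1) ×ˢ Finset.range (2 ^ ((m - 5) / 2) + 1)).filter
              (fun p => p.1 + p.2 = r),
            (-1 : ℤ) ^ p.1 * (d.choose p.1) * ((n - 2 * d).choose (2 * p.2)) := by
  classical
  intro r hr2 hrn hpos
  letI : Fintype (GaloisField 2 m) := Fintype.ofFinite _
  letI : Fintype (Dset m u ρ) := Fintype.ofFinite _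
  have hF : Fintype.card (GaloisField 2 m) = 2 ^ m := by
    rw [← Nat.card_eq_fintype_card, GaloisField.card 2 m (by omega)]
  have hD : ∀ x, x ∈ Dset m u ρ ↔ Algebra.trace (ZMod 2) (GaloisField 2 m) x = 1 ∧
      Algebra.trace (ZMod 2) (GaloisField 2 m) (x ^ (2 ^ u + 1)) = ρ := fun x => Iff.rfl
  have hcard := card_defset u m hF hm hmodd hgcd ρ hρ (Dset m u ρ) hD
  have hnd : n = 2 * d + 2 ^ ((m - 3) / 2) := by
    have : m - 2 = (m - 3) + 1 := by omega
    rw [hn, hd, this, pow_succ]; ring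
  have hcode : CodeData (fun b => codeMap m u ρ b) (1 : GaloisField 2 m) d (2 ^ ((m - 3) / 2)) :=
    { add := fun b b' i => by rw [map_add]; rfl
      o_ne := one_ne_zero
      one := fun i => by
        change Algebra.trace (ZMod 2) (GaloisField 2 m) (1 * i.1) = 1
        rw [one_mul]; exact i.2.1
      card := by rw [hcard, ← hn, hnd]
      epos := by positivity
      sums := fun b hb0 hb1 => by
        have := charSum_values u m hF hm hmodd hgcd ρ (Dset m u ρ) hD b hb0 hb1
        push_cast
        exact this
      orth := fun p q hpq => by
        have hne : (p.1 - q.1) ≠ 0 := sub_ne_zero.mpr (fun h => hpq (Subtype.ext h))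
        obtain ⟨b, hb⟩ := exists_trace_ne (p.1 - q.1) hne
        refine ⟨b, fun h => hb ?_⟩
        rw [mul_sub, map_sub, sub_eq_zero]
        exact h }
  have hDl : ∀ x, x ∈ dualCode (codeD m u ρ : Set (↥(Dset m u ρ) → ZMod 2)) ↔
      ∀ b, ∑ i, x i * codeMap m u ρ b i = 0 := by
    intro x
    constructor
    · intro h b
      rw [← finsum_eq_sum_of_fintype]
      exact h _ ⟨b, rfl⟩
    · rintro h _ ⟨b, rfl⟩
      rw [finsum_eq_sum_of_fintype]
      exact h b
  have h2n : 2 ≤ 2 * d + 2 ^ ((m - 3) / 2) := by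
    have : 0 < 2 ^ (m - 3) := by positivity
    omega
  refine ⟨?_, ?_⟩
  · obtain ⟨lam, hlam⟩ := hcode.design _ hDl r h2n
    refine ⟨lam, hlam, ?_⟩
    have := double_count _ _ _ hlam
    rwa [hcard, ← hn] at this
  · have h1 := hcode.count m hF (by omega) _ hDl r
    have hf : 2 ^ ((m - 3) / 2) = 2 * 2 ^ ((m - 5) / 2) := by
      have : (m - 3) / 2 = (m - 5) / 2 + 1 := by omega
      rw [this, pow_succ, mul_comm]
    rw [h1, coeff_formula _ _ _ _ hf, ← hnd]
    have : n - 2 * d = 2 ^ ((m - 3) / 2) := by omega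
    rw [this]
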